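/- Assume each f_i is additionally differentiable, and suppose (W*, p*) is an optimal primal-dual pair: W* is feasible (G_ik(W*_i, W*_k) = 0 for all (i,k) ∈ Ê) and W* minimizes the Lagrangian W ↦ Σ_{i∈N} f_i(W_i) + Σ_{(i,k)∈Ê} ⟨p*_ik, G_ik(W_i, W_k)⟩ over ∏_{i∈N} 𝒲_i. Let (Wⁿ, pⁿ) be given and let (W^{n+1}, p^{n+1}) be produced by one scheduled-asynchronous update. Then Σ_{(i,k)∈Ê} ρ_ik ⟨ D_ki(W_k^{n+1} − W_kⁿ), D_ik(W_i^{n+1} − W*_i) ⟩ ≥ Σ_{(i,k)∈Ê} ⟨ p_ik^{n+1} − p*_ik, r_ik^{n+1} ⟩, where r_ik^{n+1} := G_ik(W_i^{n+1}, W_k^{n+1}). -/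

import Mathlib

open Finset RealInnerProductSpace

/-- The coupling constraint map `G_ik(W_i, W_k) = D_ik(W_i) + D_ki(W_k)` for a directed
edge `e = (i,k)`, evaluated at the profile `W`. -/
noncomputable def Gmap {ι : Type*} {m : ℕ} {H : ι → Type*}
    [∀ i, NormedAddCommGroup (H i)] [∀ i, InnerProductSpace ℝ (H i)]
    (Dt : ∀ e : ι × ι, H e.1 →ₗ[ℝ] EuclideanSpace ℝ (Fin m))
    (Dh : ∀ e : ι × ι, H e.2 →ₗ[ℝ] EuclideanSpace ℝ (Fin m))
    (W : ∀ i, H i) (e : ι × ι) : EuclideanSpace ℝ (Fin m) :=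
  Dt e (W e.1) + Dh e (W e.2)

/-- The objective of the local subproblem at node `i` in one scheduled-asynchronous
update: out-edges `(i,k)` use the previous value `W0 k` of the head node, while in-edges
`(k,i)` use the already-updated value `W1 k` of the tail node. -/
noncomputable def updObj {ι : Type*} [DecidableEq ι] {m : ℕ} {H : ι → Type*}
    [∀ i, NormedAddCommGroup (H i)] [∀ i, InnerProductSpace ℝ (H i)]
    (Ehat : Finset (ι × ι))
    (Dt : ∀ e : ι × ι, H e.1 →ₗ[ℝ] EuclideanSpace ℝ (Fin m))
    (Dh : ∀ e : ι × ι, H e.2 →ₗ[ℝ] EuclideanSpace ℝ (Fin m))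
    (ρ : ι × ι → ℝ) (f : ∀ i, H i → ℝ)
    (p : ι × ι → EuclideanSpace ℝ (Fin m))
    (W0 W1 : ∀ i, H i) (i : ι) (x : H i) : ℝ :=
  f i x
  + ∑ e ∈ Ehat.filter (fun e => e.1 = i),
      (⟪p e, Gmap Dt Dh (Function.update W0 i x) e⟫
        + ρ e / 2 * ‖Gmap Dt Dh (Function.update W0 i x) e‖ ^ 2)
  + ∑ e ∈ Ehat.filter (fun e => e.2 = i),
      (⟪p e, Gmap Dt Dh (Function.update W1 i x) e⟫
        + ρ e / 2 * ‖Gmap Dt Dh (Function.update W1 i x) e‖ ^ 2)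

/-- One scheduled-asynchronous update `(W0, p0) ↦ (W1, p1)`: every node `i` picks
`W1 i` as a minimizer of its local subproblem over `𝒲 i`, and every edge `(i,k) ∈ Ehat`
updates its multiplier by `p1 = p0 + ρ • G(W1)`. -/
def IsScheduledUpdate {ι : Type*} [DecidableEq ι] {m : ℕ} {H : ι → Type*}
    [∀ i, NormedAddCommGroup (H i)] [∀ i, InnerProductSpace ℝ (H i)]
    (Ehat : Finset (ι × ι))
    (Dt : ∀ e : ι × ι, H e.1 →ₗ[ℝ] EuclideanSpace ℝ (Fin m))
    (Dh : ∀ e : ι × ι, H e.2 →ₗ[ℝ] EuclideanSpace ℝ (Fin m))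
    (ρ : ι × ι → ℝ) (f : ∀ i, H i → ℝ) (𝒲 : ∀ i, Set (H i))
    (W0 W1 : ∀ i, H i) (p0 p1 : ι × ι → EuclideanSpace ℝ (Fin m)) : Prop :=
  (∀ i, W1 i ∈ 𝒲 i ∧ ∀ x ∈ 𝒲 i,
      updObj Ehat Dt Dh ρ f p0 W0 W1 i (W1 i) ≤ updObj Ehat Dt Dh ρ f p0 W0 W1 i x)
  ∧ ∀ e ∈ Ehat, p1 e = p0 e + ρ e • Gmap Dt Dh W1 e

/-- First-order optimality for a convex function plus a function that is quadratic along the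
segment from `x` to `y`. -/
theorem ConvexOn.le_add_of_isMinOn_add_quadratic {E : Type*} [AddCommGroup E] [Module ℝ E]
    {s : Set E} {f q : E → ℝ} (hf : ConvexOn ℝ s f) {x y : E} (hx : x ∈ s) (hy : y ∈ s)
    (hmin : ∀ z ∈ s, f x + q x ≤ f z + q z) {L Q : ℝ}
    (hq : ∀ t : ℝ, q (x + t • (y - x)) = q x + t * L + t ^ 2 * Q) :
    f x ≤ f y + L := by
  have key : ∀ t : ℝ, 0 < t → t ≤ 1 → 0 ≤ (f y + L - f x) + t * Q := by
    intro t ht ht1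
    have hz : x + t • (y - x) = (1 - t) • x + t • y := by module
    have hmem : x + t • (y - x) ∈ s := by
      rw [hz]
      exact hf.1 hx hy (by linarith) ht.le (by ring)
    have h := hmin _ hmem
    rw [hq] at h
    have hc : f (x + t • (y - x)) ≤ (1 - t) * f x + t * f y := by
      rw [hz]
      exact hf.2 hx hy (by linarith) ht.le (by ring)
    refine nonneg_of_mul_nonneg_right (a := t) ?_ ht
    linarith
  have hlim : Filter.Tendsto (fun t : ℝ => (f y + L - f x) + t * Q)
      (nhdsWithin 0 (Set.Ioi 0)) (nhds ((f y + L - f x) + 0 * Q)) :=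
    ((by fun_prop : Continuous fun t : ℝ => (f y + L - f x) + t * Q).tendsto 0).mono_left
      nhdsWithin_le_nhds
  have h0 : 0 ≤ (f y + L - f x) + 0 * Q := by
    refine ge_of_tendsto hlim ?_
    filter_upwards [Ioc_mem_nhdsGT (zero_lt_one : (0 : ℝ) < 1)] with t ht
    exact key t ht.1 ht.2
  linarith

/-- Expansion of an augmented-Lagrangian penalty along a line. -/
theorem sum_inner_add_sq_norm_add_smul {α F : Type*} [NormedAddCommGroup F]
    [InnerProductSpace ℝ F] (s : Finset α) (ρ : α → ℝ) (p a b : α → F) (t : ℝ) :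
    ∑ e ∈ s, (⟪p e, a e + t • b e⟫ + ρ e / 2 * ‖a e + t • b e‖ ^ 2)
      = ∑ e ∈ s, (⟪p e, a e⟫ + ρ e / 2 * ‖a e‖ ^ 2)
        + t * ∑ e ∈ s, ⟪p e + ρ e • a e, b e⟫ + t ^ 2 * ∑ e ∈ s, ρ e / 2 * ‖b e‖ ^ 2 := by
  rw [Finset.mul_sum, Finset.mul_sum, ← Finset.sum_add_distrib, ← Finset.sum_add_distrib]
  refine Finset.sum_congr rfl fun e _ => ?_
  rw [norm_add_sq_real, norm_smul, mul_pow, Real.norm_eq_abs, sq_abs]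
  simp only [inner_add_right, inner_add_left, real_inner_smul_left, real_inner_smul_right]
  ring

section Gmap

variable {ι : Type*} [DecidableEq ι] {m : ℕ} {H : ι → Type*}
  [∀ i, NormedAddCommGroup (H i)] [∀ i, InnerProductSpace ℝ (H i)]
  (Dt : ∀ e : ι × ι, H e.1 →ₗ[ℝ] EuclideanSpace ℝ (Fin m))
  (Dh : ∀ e : ι × ι, H e.2 →ₗ[ℝ] EuclideanSpace ℝ (Fin m))

theorem Gmap_update_add_smul (W : ∀ i, H i) (i : ι) (x d : H i) (t : ℝ) (e : ι × ι) :
    Gmap Dt Dh (Function.update W i (x + t • d)) e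
      = Gmap Dt Dh (Function.update W i x) e + t • Gmap Dt Dh (Pi.single i d) e := by
  have h : Function.update W i (x + t • d) = Function.update W i x + t • Pi.single i d := by
    funext j
    by_cases hj : j = i
    · subst hj
      simp
    · simp [hj]
  rw [h]
  simp only [Gmap, Pi.add_apply, Pi.smul_apply, map_add, map_smul]
  module

theorem Gmap_single_fst (V : ∀ i, H i) {e : ι × ι} (he : e.1 ≠ e.2) :
    Gmap Dt Dh (Pi.single e.1 (V e.1)) e = Dt e (V e.1) := by
  simp [Gmap, he.symm]

theorem Gmap_single_snd (V : ∀ i, H i) {e : ι × ι} (he : e.1 ≠ e.2) :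
    Gmap Dt Dh (Pi.single e.2 (V e.2)) e = Dh e (V e.2) := by
  simp [Gmap, he]

theorem Gmap_update_fst (W V : ∀ i, H i) {e : ι × ι} (he : e.1 ≠ e.2) :
    Gmap Dt Dh (Function.update W e.1 (V e.1)) e = Dt e (V e.1) + Dh e (W e.2) := by
  simp [Gmap, he.symm]

/-- Variational inequality satisfied by the minimizer of a node's local subproblem, in terms of
the updated multipliers. -/
theorem IsScheduledUpdate.le_add_sum_inner {Ehat : Finset (ι × ι)}
    (hEloop : ∀ e ∈ Ehat, e.1 ≠ e.2) {Dt Dh} {ρ : ι × ι → ℝ} {f : ∀ i, H i → ℝ}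
    {𝒲 : ∀ i, Set (H i)} (hf : ∀ i, ConvexOn ℝ (𝒲 i) (f i))
    {W0 W1 : ∀ i, H i} {p0 p1 : ι × ι → EuclideanSpace ℝ (Fin m)}
    (hupd : IsScheduledUpdate Ehat Dt Dh ρ f 𝒲 W0 W1 p0 p1)
    {W : ∀ i, H i} (hW : ∀ i, W i ∈ 𝒲 i) (i : ι) :
    f i (W1 i) ≤ f i (W i)
      + (∑ e ∈ Ehat.filter (fun e => e.1 = i),
          ⟪p1 e - ρ e • Dh e (W1 e.2 - W0 e.2), Dt e (W e.1 - W1 e.1)⟫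
        + ∑ e ∈ Ehat.filter (fun e => e.2 = i), ⟪p1 e, Dh e (W e.2 - W1 e.2)⟫) := by
  have key := (hf i).le_add_of_isMinOn_add_quadratic
    (q := fun x => updObj Ehat Dt Dh ρ f p0 W0 W1 i x - f i x) (hupd.1 i).1 (hW i)
    (fun z hz => by simpa using (hupd.1 i).2 z hz)
    (L := ∑ e ∈ Ehat.filter (fun e => e.1 = i),
          ⟪p0 e + ρ e • Gmap Dt Dh (Function.update W0 i (W1 i)) e,
            Gmap Dt Dh (Pi.single i (W i - W1 i)) e⟫
        + ∑ e ∈ Ehat.filter (fun e => e.2 = i),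
          ⟪p0 e + ρ e • Gmap Dt Dh (Function.update W1 i (W1 i)) e,
            Gmap Dt Dh (Pi.single i (W i - W1 i)) e⟫)
    (Q := ∑ e ∈ Ehat.filter (fun e => e.1 = i),
          ρ e / 2 * ‖Gmap Dt Dh (Pi.single i (W i - W1 i)) e‖ ^ 2
        + ∑ e ∈ Ehat.filter (fun e => e.2 = i),
          ρ e / 2 * ‖Gmap Dt Dh (Pi.single i (W i - W1 i)) e‖ ^ 2)
    (fun t => by
      simp only [updObj, Gmap_update_add_smul, sum_inner_add_sq_norm_add_smul]
      ring)
  refine key.trans_eq ?_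
  congr 2
  · refine Finset.sum_congr rfl fun e he => ?_
    obtain ⟨hmem, rfl⟩ := Finset.mem_filter.1 he
    have hs := Gmap_single_fst Dt Dh (W - W1) (hEloop e hmem)
    rw [Pi.sub_apply] at hs
    rw [hs, Gmap_update_fst Dt Dh W0 W1 (hEloop e hmem), hupd.2 e hmem, Gmap, map_sub (Dh e)]
    congr 1
    module
  · refine Finset.sum_congr rfl fun e he => ?_
    obtain ⟨hmem, rfl⟩ := Finset.mem_filter.1 he
    have hs := Gmap_single_snd Dt Dh (W - W1) (hEloop e hmem)
    rw [Pi.sub_apply] at hs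
    rw [hs, Function.update_eq_self, hupd.2 e hmem]

end Gmap

/-- if `(Wstar, pstar)` is an optimal primal-dual pair and
`(W1, p1)` results from one scheduled-asynchronous update of `(W0, p0)`, then
`∑_e ρ_e ⟪D_ki(W1_k − W0_k), D_ik(W1_i − Wstar_i)⟫ ≥ ∑_e ⟪p1_e − pstar_e, r_e⟫`
with `r_e = G_e(W1)`. -/
theorem stmt3 {ι : Type*} [Fintype ι] [DecidableEq ι] {m : ℕ} {H : ι → Type*}
    [∀ i, NormedAddCommGroup (H i)] [∀ i, InnerProductSpace ℝ (H i)]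
    [∀ i, FiniteDimensional ℝ (H i)]
    (Ehat : Finset (ι × ι)) (hEloop : ∀ e ∈ Ehat, e.1 ≠ e.2)
    (hEor : ∀ e ∈ Ehat, (e.2, e.1) ∉ Ehat)
    (Dt : ∀ e : ι × ι, H e.1 →ₗ[ℝ] EuclideanSpace ℝ (Fin m))
    (Dh : ∀ e : ι × ι, H e.2 →ₗ[ℝ] EuclideanSpace ℝ (Fin m))
    (ρ : ι × ι → ℝ) (hρ : ∀ e ∈ Ehat, 0 < ρ e)
    (𝒲 : ∀ i, Set (H i))
    (h𝒲 : ∀ i, (𝒲 i).Nonempty ∧ IsCompact (𝒲 i) ∧ Convex ℝ (𝒲 i))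
    (f : ∀ i, H i → ℝ)
    (hf : ∀ i, ConvexOn ℝ Set.univ (f i)) (hfd : ∀ i, Differentiable ℝ (f i))
    (Wstar : ∀ i, H i) (pstar : ι × ι → EuclideanSpace ℝ (Fin m))
    (hWstar𝒲 : ∀ i, Wstar i ∈ 𝒲 i)
    (hfeas : ∀ e ∈ Ehat, Gmap Dt Dh Wstar e = 0)
    (hlagr : ∀ W : ∀ i, H i, (∀ i, W i ∈ 𝒲 i) →
      (∑ i, f i (Wstar i)) + ∑ e ∈ Ehat, ⟪pstar e, Gmap Dt Dh Wstar e⟫ ≤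
        (∑ i, f i (W i)) + ∑ e ∈ Ehat, ⟪pstar e, Gmap Dt Dh W e⟫)
    (W0 W1 : ∀ i, H i) (hW0 : ∀ i, W0 i ∈ 𝒲 i)
    (p0 p1 : ι × ι → EuclideanSpace ℝ (Fin m))
    (hupd : IsScheduledUpdate Ehat Dt Dh ρ f 𝒲 W0 W1 p0 p1) :
    ∑ e ∈ Ehat, ρ e * ⟪Dh e (W1 e.2 - W0 e.2), Dt e (W1 e.1 - Wstar e.1)⟫
      ≥ ∑ e ∈ Ehat, ⟪p1 e - pstar e, Gmap Dt Dh W1 e⟫ := by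
  have hsum := Finset.sum_le_sum fun i (_ : i ∈ Finset.univ) =>
    hupd.le_add_sum_inner hEloop
      (fun i => (hf i).subset (Set.subset_univ _) (h𝒲 i).2.2) hWstar𝒲 i
  simp only [Finset.sum_add_distrib, Finset.sum_fiberwise] at hsum
  rw [← Finset.sum_add_distrib] at hsum
  have hlag := hlagr W1 fun i => (hupd.1 i).1
  have hzero : ∑ e ∈ Ehat, ⟪pstar e, Gmap Dt Dh Wstar e⟫ = 0 :=
    Finset.sum_eq_zero fun e he => by rw [hfeas e he, inner_zero_right]
  have hedge : ∀ e ∈ Ehat,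
      ⟪p1 e - ρ e • Dh e (W1 e.2 - W0 e.2), Dt e (Wstar e.1 - W1 e.1)⟫
          + ⟪p1 e, Dh e (Wstar e.2 - W1 e.2)⟫
        = ρ e * ⟪Dh e (W1 e.2 - W0 e.2), Dt e (W1 e.1 - Wstar e.1)⟫
          - ⟪p1 e, Gmap Dt Dh W1 e⟫ := by
    intro e he
    have hD : Dt e (Wstar e.1) = -Dh e (Wstar e.2) := eq_neg_of_add_eq_zero_left (hfeas e he)
    simp only [Gmap, map_sub, hD, inner_sub_left, inner_sub_right, inner_add_right,
      inner_neg_right, real_inner_smul_left]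
    ring
  rw [Finset.sum_congr rfl hedge, Finset.sum_sub_distrib] at hsum
  simp only [inner_sub_left (p1 _), Finset.sum_sub_distrib]
  linarith
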